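/- Let T be a random variable taking values in [1,∞] with E[1/T] > 0, and write m = 1/E[1/T] ∈ [1,∞). Then for every a > 0, inf_{q∈(0,1]} Q_p(q)/q ≤ (1 + 1/a)^{1+a} · m^{1+a}. -/

import Mathlib

open MeasureTheory ENNReal

/-- The `q`-quantile of the distribution of `T`:
`Q_p(q) = inf {α ∈ [1,∞) : P(T ≤ α) ≥ q}`, equal to `∞` if no such `α` exists. -/
noncomputable def quantile {Ω : Type*} [MeasurableSpace Ω] (μ : Measure Ω)
    (T : Ω → ℝ≥0∞) (q : ℝ≥0∞) : ℝ≥0∞ :=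
  sInf {α : ℝ≥0∞ | 1 ≤ α ∧ α ≠ ⊤ ∧ q ≤ μ {ω | T ω ≤ α}}

/-- Testing the infimum at `q = P(T ≤ α)` bounds `P(T ≤ α)` from above. -/
lemma iInf_quantile_div_mul_measure_le {Ω : Type*} [MeasurableSpace Ω] (μ : Measure Ω)
    [IsProbabilityMeasure μ] (T : Ω → ℝ≥0∞) {α : ℝ≥0∞} (h1 : 1 ≤ α) (htop : α ≠ ⊤) :
    (⨅ q ∈ Set.Ioc (0 : ℝ≥0∞) 1, quantile μ T q / q) * μ {ω | T ω ≤ α} ≤ α := by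
  rcases eq_or_ne (μ {ω | T ω ≤ α}) 0 with h0 | h0
  · simp [h0]
  · refine ENNReal.mul_le_of_le_div ?_
    refine (iInf₂_le (μ {ω | T ω ≤ α}) ⟨pos_iff_ne_zero.2 h0, prob_le_one⟩).trans ?_
    gcongr
    exact sInf_le ⟨h1, htop, le_rfl⟩

lemma lintegral_Ioc_zero_one_rpow {s : ℝ} (hs : -1 < s) :
    ∫⁻ x in Set.Ioc (0 : ℝ) 1, ENNReal.ofReal (x ^ s) = ENNReal.ofReal (1 / (s + 1)) := by
  have hint : IntegrableOn (fun x : ℝ => x ^ s) (Set.Ioc 0 1) :=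
    (intervalIntegrable_iff_integrableOn_Ioc_of_le zero_le_one).1
      (intervalIntegral.intervalIntegrable_rpow' hs)
  rw [← ofReal_integral_eq_lintegral_ofReal hint, ← intervalIntegral.integral_of_le zero_le_one,
    integral_rpow (Or.inl hs), Real.one_rpow, Real.zero_rpow (by linarith), sub_zero]
  filter_upwards [ae_restrict_mem measurableSet_Ioc] with x hx
  exact Real.rpow_nonneg hx.1.le s

/-- A weak-type tail bound `P(T ≤ α) ≤ α / L` for finite `α ≥ 1` controls `E[1/T]`. -/
lemma lintegral_inv_le_of_mul_measure_le {Ω : Type*} [MeasurableSpace Ω] (μ : Measure Ω)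
    [IsProbabilityMeasure μ] {T : Ω → ℝ≥0∞} (hTmeas : Measurable T) (hT1 : ∀ ω, 1 ≤ T ω)
    {L : ℝ≥0∞} (hL : ∀ α : ℝ≥0∞, 1 ≤ α → α ≠ ⊤ → L * μ {ω | T ω ≤ α} ≤ α)
    {r : ℝ} (hr0 : 0 < r) (hr1 : r < 1) :
    ∫⁻ ω, (T ω)⁻¹ ∂μ ≤ L⁻¹ ^ r * ENNReal.ofReal (1 / (1 - r)) := by
  have hinv_le : ∀ ω, (T ω)⁻¹ ≤ 1 := fun ω => ENNReal.inv_le_one.2 (hT1 ω)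
  have hinv_top : ∀ ω, (T ω)⁻¹ ≠ ⊤ := fun ω => ((hinv_le ω).trans_lt one_lt_top).ne
  have htail : ∀ t ∈ Set.Ioi (0 : ℝ), μ {ω | t ≤ (T ω)⁻¹.toReal} ≤
      (Set.Ioc (0 : ℝ) 1).indicator (fun x => L⁻¹ ^ r * ENNReal.ofReal (x ^ (-r))) t := by
    intro t ht
    have ht0 : 0 < t := ht
    by_cases ht1 : t ≤ 1
    · rw [Set.indicator_of_mem (show t ∈ Set.Ioc (0 : ℝ) 1 from ⟨ht, ht1⟩)]
      have hset : {ω | t ≤ (T ω)⁻¹.toReal} = {ω | T ω ≤ (ENNReal.ofReal t)⁻¹} := by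
        ext ω
        simp only [Set.mem_ofPred_eq]
        rw [← ENNReal.ofReal_le_iff_le_toReal (hinv_top ω), ENNReal.le_inv_iff_le_inv]
      have hα := hL (ENNReal.ofReal t)⁻¹
        (ENNReal.one_le_inv.2 (ENNReal.ofReal_le_one.2 ht1)) (by simpa using ht0)
      have hbase : μ {ω | T ω ≤ (ENNReal.ofReal t)⁻¹} ≤ L⁻¹ * (ENNReal.ofReal t)⁻¹ := by
        rw [mul_comm, ← div_eq_mul_inv]
        refine (ENNReal.le_div_iff_mul_le (Or.inr (by simp)) (Or.inr (by simpa using ht0))).2 ?_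
        rwa [mul_comm]
      rw [hset]
      calc μ {ω | T ω ≤ (ENNReal.ofReal t)⁻¹}
          = μ {ω | T ω ≤ (ENNReal.ofReal t)⁻¹} ^ (1 : ℝ) := (ENNReal.rpow_one _).symm
        _ ≤ μ {ω | T ω ≤ (ENNReal.ofReal t)⁻¹} ^ r :=
            ENNReal.rpow_le_rpow_of_exponent_ge prob_le_one hr1.le
        _ ≤ (L⁻¹ * (ENNReal.ofReal t)⁻¹) ^ r := ENNReal.rpow_le_rpow hbase hr0.le
        _ = L⁻¹ ^ r * ENNReal.ofReal (t ^ (-r)) := by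
            rw [ENNReal.mul_rpow_of_nonneg _ _ hr0.le, ← ENNReal.ofReal_rpow_of_pos ht0,
              ENNReal.inv_rpow (ENNReal.ofReal t), ENNReal.rpow_neg]
    · have hempty : {ω | t ≤ (T ω)⁻¹.toReal} = ∅ := by
        ext ω
        simp only [Set.mem_ofPred_eq, Set.mem_empty_iff_false, iff_false, not_le]
        exact (ENNReal.toReal_mono one_ne_top (hinv_le ω)).trans_lt (by simpa using ht1)
      rw [hempty, measure_empty]
      exact zero_le
  calc ∫⁻ ω, (T ω)⁻¹ ∂μ
      = ∫⁻ ω, ENNReal.ofReal (T ω)⁻¹.toReal ∂μ := by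
        simp only [ENNReal.ofReal_toReal (hinv_top _)]
    _ = ∫⁻ t in Set.Ioi (0 : ℝ), μ {ω | t ≤ (T ω)⁻¹.toReal} :=
        lintegral_eq_lintegral_meas_le μ (Filter.Eventually.of_forall fun _ => toReal_nonneg)
          hTmeas.inv.ennreal_toReal.aemeasurable
    _ ≤ ∫⁻ t in Set.Ioi (0 : ℝ), (Set.Ioc (0 : ℝ) 1).indicator
          (fun x => L⁻¹ ^ r * ENNReal.ofReal (x ^ (-r))) t :=
        setLIntegral_mono' measurableSet_Ioi htail
    _ ≤ ∫⁻ t, (Set.Ioc (0 : ℝ) 1).indicator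
          (fun x => L⁻¹ ^ r * ENNReal.ofReal (x ^ (-r))) t := setLIntegral_le_lintegral _ _
    _ = L⁻¹ ^ r * ENNReal.ofReal (1 / (1 - r)) := by
        rw [lintegral_indicator measurableSet_Ioc, lintegral_const_mul _ (by fun_prop),
          lintegral_Ioc_zero_one_rpow (by linarith), neg_add_eq_sub]

/-- For a random variable `T` with values in `[1,∞]` with `E[1/T] > 0` and
`m = 1/E[1/T]`, for every `a > 0`,
`inf_{q ∈ (0,1]} Q_p(q)/q ≤ (1 + 1/a)^{1+a} · m^{1+a}`. -/
theorem stmt15 {Ω : Type*} [MeasurableSpace Ω] (μ : Measure Ω) [IsProbabilityMeasure μ]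
    (T : Ω → ℝ≥0∞) (hTmeas : Measurable T) (hT1 : ∀ ω, 1 ≤ T ω)
    (hE : 0 < ∫⁻ ω, (T ω)⁻¹ ∂μ) (a : ℝ) (ha : 0 < a) :
    (⨅ q ∈ Set.Ioc (0 : ℝ≥0∞) 1, quantile μ T q / q)
      ≤ ENNReal.ofReal ((1 + 1 / a) ^ (1 + a))
          * ((∫⁻ ω, (T ω)⁻¹ ∂μ)⁻¹) ^ (1 + a) := by
  have ha1 : 0 < 1 + a := by linarith
  have hbound := lintegral_inv_le_of_mul_measure_le μ hTmeas hT1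
    (fun α h1 htop => iInf_quantile_div_mul_measure_le μ T h1 htop)
    (r := 1 / (1 + a)) (by positivity) (by rw [div_lt_one ha1]; linarith)
  have hconst : 1 / (1 - 1 / (1 + a)) = 1 + 1 / a := by
    have : 1 - 1 / (1 + a) = a / (1 + a) := by field_simp; ring
    rw [this]; field_simp; ring
  have hE_le : ∫⁻ ω, (T ω)⁻¹ ∂μ ≤ 1 := by
    calc ∫⁻ ω, (T ω)⁻¹ ∂μ ≤ ∫⁻ _, 1 ∂μ := lintegral_mono fun ω => ENNReal.inv_le_one.2 (hT1 ω)
      _ = 1 := by simp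
  have hE_top : ∫⁻ ω, (T ω)⁻¹ ∂μ ≠ ⊤ := (hE_le.trans_lt one_lt_top).ne
  have hpow := ENNReal.rpow_le_rpow hbound ha1.le
  rw [hconst, ENNReal.mul_rpow_of_nonneg _ _ ha1.le, ← ENNReal.rpow_mul,
    one_div_mul_cancel ha1.ne', ENNReal.rpow_one, ENNReal.ofReal_rpow_of_pos (by positivity),
    mul_comm, ← div_eq_mul_inv] at hpow
  rw [ENNReal.inv_rpow, ← div_eq_mul_inv]
  refine (ENNReal.le_div_iff_mul_le (Or.inl (ENNReal.rpow_pos hE hE_top).ne')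
    (Or.inl (ENNReal.rpow_ne_top_of_nonneg ha1.le hE_top))).2 ?_
  rw [mul_comm]
  exact ENNReal.mul_le_of_le_div hpow
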